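/- Sharp sextic Gagliardo–Nirenberg constant on the grid (Proposition 4.3): the optimal constant K_6 = sup{‖u‖_{L^6(𝒢)}^6 / (‖u‖_{L²(𝒢)}^4 ‖u'‖_{L²(𝒢)}²) : u ∈ H¹(𝒢), u not identically 0} equals 4/π², and consequently the critical mass μ_6 = (3/K_6)^{1/2} equals π√3/2; moreover the supremum defining K_6 is the same as the optimal constant in the corresponding Gagliardo–Nirenberg inequality on the real line ℝ. -/

import Mathlib

/- Formalization of NLS ground states on the two-dimensional grid 𝒢
   (the planar metric graph with vertex set ℤ×ℤ and unit edges).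

   A function `u` on 𝒢 is encoded by the family `h j` of its restrictions to
   the horizontal lines `H j` and the family `w k` of its restrictions to the
   vertical lines `V k`, subject to the vertex-compatibility conditions
   `h j k = w k j`.  The (weak) derivative of `u` along each line is carried
   as additional data `hd`, `wd`, tied to `h`, `w` by the fundamental theorem
   of calculus in the membership predicates below. -/

open MeasureTheory Filter Topology
open scoped ENNReal NNReal

noncomputable section

/-- A function on the grid 𝒢, together with candidate derivatives along
horizontal and vertical lines. -/
structure GridFunc where
  /-- restriction to the horizontal line `H j` -/
  h : ℤ → ℝ → ℝ
  /-- restriction to the vertical line `V k` -/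
  w : ℤ → ℝ → ℝ
  /-- derivative along the horizontal line `H j` -/
  hd : ℤ → ℝ → ℝ
  /-- derivative along the vertical line `V k` -/
  wd : ℤ → ℝ → ℝ
  /-- vertex compatibility: the values at the vertex `(k, j)` agree -/
  compat : ∀ j k : ℤ, h j (k : ℝ) = w k (j : ℝ)

/-- `∑_j ∫_ℝ |f j|^p + ∑_k ∫_ℝ |g k|^p`, as an extended nonnegative real:
the `p`-th power of the `L^p(𝒢)` norm of the function encoded by `(f, g)`. -/
def gridLpPow (p : ℝ) (f g : ℤ → ℝ → ℝ) : ℝ≥0∞ :=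
  (∑' j : ℤ, ∫⁻ x : ℝ, (‖f j x‖₊ : ℝ≥0∞) ^ p) +
  (∑' k : ℤ, ∫⁻ y : ℝ, (‖g k y‖₊ : ℝ≥0∞) ^ p)

/-- The `L^p(𝒢)` norm of `u`. -/
def GridFunc.lpNorm (u : GridFunc) (p : ℝ) : ℝ≥0∞ :=
  gridLpPow p u.h u.w ^ (1 / p)

/-- The `L^p(𝒢)` norm of the derivative `u'`. -/
def GridFunc.derivLpNorm (u : GridFunc) (p : ℝ) : ℝ≥0∞ :=
  gridLpPow p u.hd u.wd ^ (1 / p)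

/-- The `L^∞(𝒢)` norm of `u`: the sup over all lines of the sup norms. -/
def GridFunc.linfNorm (u : GridFunc) : ℝ≥0∞ :=
  (⨆ j : ℤ, ⨆ x : ℝ, (‖u.h j x‖₊ : ℝ≥0∞)) ⊔
  (⨆ k : ℤ, ⨆ y : ℝ, (‖u.w k y‖₊ : ℝ≥0∞))

/-- `u ∈ H¹(𝒢)`: every line restriction is continuous and is recovered from
its (locally integrable) derivative by integration, and both `‖u‖₂²` and
`‖u'‖₂²` are finite. -/
def GridFunc.MemH1 (u : GridFunc) : Prop :=
  (∀ j, Continuous (u.h j)) ∧ (∀ k, Continuous (u.w k)) ∧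
  (∀ j, LocallyIntegrable (u.hd j)) ∧ (∀ k, LocallyIntegrable (u.wd k)) ∧
  (∀ j x, (∫ t in (0:ℝ)..x, u.hd j t) = u.h j x - u.h j 0) ∧
  (∀ k y, (∫ t in (0:ℝ)..y, u.wd k t) = u.w k y - u.w k 0) ∧
  gridLpPow 2 u.h u.w < ⊤ ∧ gridLpPow 2 u.hd u.wd < ⊤

/-- `u ∈ W^{1,1}(𝒢)`: every line restriction is continuous and is recovered
from its (integrable) derivative by integration, and both `‖u‖₁` and `‖u'‖₁`
are finite. -/
def GridFunc.MemW11 (u : GridFunc) : Prop :=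
  (∀ j, Continuous (u.h j)) ∧ (∀ k, Continuous (u.w k)) ∧
  (∀ j, Integrable (u.hd j)) ∧ (∀ k, Integrable (u.wd k)) ∧
  (∀ j x, (∫ t in (0:ℝ)..x, u.hd j t) = u.h j x - u.h j 0) ∧
  (∀ k y, (∫ t in (0:ℝ)..y, u.wd k t) = u.w k y - u.w k 0) ∧
  gridLpPow 1 u.h u.w < ⊤ ∧ gridLpPow 1 u.hd u.wd < ⊤

/-- The mass `‖u‖_{L²(𝒢)}²` of `u`, as a real number. -/
def GridFunc.mass (u : GridFunc) : ℝ :=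
  (gridLpPow 2 u.h u.w).toReal

/-- The NLS energy `E_p(u) = ½‖u'‖₂² − (1/p)‖u‖_p^p`. -/
def GridFunc.energy (u : GridFunc) (p : ℝ) : ℝ :=
  (1 / 2) * (gridLpPow 2 u.hd u.wd).toReal
    - (1 / p) * (gridLpPow p u.h u.w).toReal

/-- `u` is not identically zero on 𝒢. -/
def GridFunc.Nonzero (u : GridFunc) : Prop :=
  (∃ j x, u.h j x ≠ 0) ∨ (∃ k y, u.w k y ≠ 0)

/-- The Gagliardo–Nirenberg quotient
`Q_p(u) = ‖u‖_p^p / (‖u‖₂^{p−2} ‖u'‖₂²)`. -/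
def GridFunc.gnQuot (u : GridFunc) (p : ℝ) : ℝ :=
  (gridLpPow p u.h u.w).toReal /
    ((gridLpPow 2 u.h u.w).toReal ^ ((p - 2) / 2) *
      (gridLpPow 2 u.hd u.wd).toReal)

/-- The set of Gagliardo–Nirenberg quotients `Q_p(u)` over nontrivial
`u ∈ H¹(𝒢)`; its supremum is the optimal constant `K_p`. -/
def gnSet (p : ℝ) : Set ℝ :=
  {q | ∃ u : GridFunc, u.MemH1 ∧ u.Nonzero ∧ q = u.gnQuot p}

/-- The critical mass `μ_p = (p/(2K))^{2/(p−2)}` associated with the optimal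
Gagliardo–Nirenberg constant `K`. -/
def critMass (p K : ℝ) : ℝ :=
  (p / (2 * K)) ^ (2 / (p - 2))

/-- The `H¹(𝒢)` inner product `⟨u,v⟩_{L²(𝒢)} + ⟨u',v'⟩_{L²(𝒢)}`. -/
def GridFunc.h1Inner (u v : GridFunc) : ℝ :=
  ((∑' j : ℤ, ∫ x : ℝ, u.h j x * v.h j x) +
    (∑' k : ℤ, ∫ y : ℝ, u.w k y * v.w k y)) +
  ((∑' j : ℤ, ∫ x : ℝ, u.hd j x * v.hd j x) +
    (∑' k : ℤ, ∫ y : ℝ, u.wd k y * v.wd k y))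

/-- The set of energies `E_p(u)` of functions `u ∈ H¹_μ(𝒢)`; its infimum is
the ground-state energy level `ℰ_p(μ)`. -/
def energySet (p μ : ℝ) : Set ℝ :=
  {e | ∃ u : GridFunc, u.MemH1 ∧ u.mass = μ ∧ u.energy p = e}

/-- `u` is a ground state of mass `μ`: it belongs to `H¹_μ(𝒢)` and minimizes
the energy `E_p` there. -/
def IsGroundState (p μ : ℝ) (u : GridFunc) : Prop :=
  u.MemH1 ∧ u.mass = μ ∧
    ∀ v : GridFunc, v.MemH1 → v.mass = μ → u.energy p ≤ v.energy p

end

open MeasureTheory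

noncomputable section

/-- `φ ∈ H¹(ℝ)`, with derivative `d`: `φ` is continuous, recovered from the
locally integrable `d` by integration, and both `φ` and `d` are in `L²(ℝ)`. -/
def MemH1R (φ d : ℝ → ℝ) : Prop :=
  Continuous φ ∧ LocallyIntegrable d ∧
  (∀ x : ℝ, (∫ t in (0:ℝ)..x, d t) = φ x - φ 0) ∧
  (∫⁻ x : ℝ, (‖φ x‖₊ : ℝ≥0∞) ^ (2 : ℝ)) < ⊤ ∧
  (∫⁻ x : ℝ, (‖d x‖₊ : ℝ≥0∞) ^ (2 : ℝ)) < ⊤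

/-- The sextic Gagliardo–Nirenberg quotient on the real line:
`‖φ‖_{L⁶(ℝ)}⁶ / (‖φ‖_{L²(ℝ)}⁴ ‖φ'‖_{L²(ℝ)}²)`. -/
def gnQuotR (φ d : ℝ → ℝ) : ℝ :=
  (∫⁻ x : ℝ, (‖φ x‖₊ : ℝ≥0∞) ^ (6 : ℝ)).toReal /
    ((∫⁻ x : ℝ, (‖φ x‖₊ : ℝ≥0∞) ^ (2 : ℝ)).toReal ^ 2 *
      (∫⁻ x : ℝ, (‖d x‖₊ : ℝ≥0∞) ^ (2 : ℝ)).toReal)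

/-- The set of sextic Gagliardo–Nirenberg quotients on ℝ over nontrivial
`φ ∈ H¹(ℝ)`; its supremum is the optimal constant `K^ℝ`. -/
def gnSetR : Set ℝ :=
  {q | ∃ φ d : ℝ → ℝ, MemH1R φ d ∧ φ ≠ 0 ∧ q = gnQuotR φ d}

section LineInequality

variable {φ d : ℝ → ℝ}

lemma line_intervalIntegrable (hd : LocallyIntegrable d) (a b : ℝ) :
    IntervalIntegrable d volume a b :=
  intervalIntegrable_iff.mpr <|
    (hd.integrableOn_isCompact isCompact_uIcc).mono_set Set.uIoc_subset_uIcc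

lemma line_ac (hd : LocallyIntegrable d)
    (hF : ∀ x : ℝ, (∫ t in (0:ℝ)..x, d t) = φ x - φ 0) (a b : ℝ) :
    AbsolutelyContinuousOnInterval φ a b := by
  have h1 := (line_intervalIntegrable hd a b).absolutelyContinuousOnInterval_intervalIntegral
    (c := a) Set.left_mem_uIcc
  have h2 : AbsolutelyContinuousOnInterval (fun _ : ℝ => φ a) a b :=
    (contDiff_const.contDiffOn).absolutelyContinuousOnInterval
  have h3 := h1.add h2
  have h4 : ((fun x ↦ ∫ v in a..x, d v) + fun _ : ℝ => φ a) = φ := by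
    funext x
    have h5 := intervalIntegral.integral_add_adjacent_intervals
      (line_intervalIntegrable hd 0 a) (line_intervalIntegrable hd a x)
    rw [hF, hF] at h5
    simp only [Pi.add_apply]
    linarith
  rwa [h4] at h3

lemma line_ae_deriv (hd : LocallyIntegrable d)
    (hF : ∀ x : ℝ, (∫ t in (0:ℝ)..x, d t) = φ x - φ 0) :
    ∀ᵐ x, HasDerivAt φ (d x) x := by
  filter_upwards [LocallyIntegrable.ae_hasDerivAt_integral hd] with x hx
  have h := (hx 0).add_const (φ 0)
  have h4 : (fun x ↦ (∫ v in (0:ℝ)..x, d v) + φ 0) = φ := by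
    funext x
    rw [hF]; ring
  rwa [h4] at h

/-- The key inequality on a bounded interval. -/
lemma line_interval_ineq (hφ : Continuous φ) (hd : LocallyIntegrable d)
    (hF : ∀ x : ℝ, (∫ t in (0:ℝ)..x, d t) = φ x - φ 0)
    (hd2 : Integrable (fun x => d x ^ 2))
    {a b β M : ℝ} (hab : a ≤ b) (hβ : 0 < β)
    (hM : (∫ x in a..b, φ x ^ 2) ≤ M) (hβM : β * M < Real.pi) :
    β ^ 2 / 4 * ∫ x in a..b, φ x ^ 6 ≤
      (∫ x in a..b, d x ^ 2) + β / 4 * (Real.tan (β * M / 2) * (φ b ^ 4 + φ a ^ 4)) := by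
  set m : ℝ → ℝ := fun x => ∫ t in a..x, φ t ^ 2 with hm
  have hm' : ∀ x, HasDerivAt m (φ x ^ 2) x := fun x =>
    intervalIntegral.integral_hasDerivAt_right ((hφ.pow 2).intervalIntegrable _ _)
      ((hφ.pow 2).stronglyMeasurableAtFilter _ _) (hφ.pow 2).continuousAt
  set θ : ℝ → ℝ := fun x => β * (m x - M / 2) with hθ
  have hθ' : ∀ x, HasDerivAt θ (β * φ x ^ 2) x := fun x =>
    ((hm' x).sub_const _).const_mul β
  have hmono : Monotone m := monotone_of_hasDerivAt_nonneg hm' (fun x => sq_nonneg _)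
  have hma : m a = 0 := by simp [hm]
  have hmb : m b ≤ M := hM
  have hM0 : 0 ≤ M := by
    have := hmono hab
    linarith
  have hrange : ∀ x ∈ Set.Icc a b, -(β * M / 2) ≤ θ x ∧ θ x ≤ β * M / 2 := by
    intro x hx
    have h1 := hmono hx.1
    have h2 := hmono hx.2
    simp only [hθ]
    constructor <;> nlinarith
  have hcos : ∀ x ∈ Set.Icc a b, 0 < Real.cos (θ x) := by
    intro x hx
    have := hrange x hx
    apply Real.cos_pos_of_mem_Ioo
    constructor <;> linarith
  have hθC : ContDiff ℝ 1 θ := by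
    rw [contDiff_one_iff_deriv]
    refine ⟨fun x => (hθ' x).differentiableAt, ?_⟩
    have : deriv θ = fun x => β * φ x ^ 2 := funext fun x => (hθ' x).deriv
    rw [this]
    fun_prop
  have htanC : ContDiffOn ℝ 1 (fun x => Real.tan (θ x)) (Set.uIcc a b) := by
    rw [Set.uIcc_of_le hab]
    intro x hx
    have h1 : ContDiffAt ℝ 1 Real.tan (θ x) := Real.contDiffAt_tan.2 (hcos x hx).ne'
    exact (h1.comp x hθC.contDiffAt).contDiffWithinAt
  have hac := line_ac hd hF a b
  have hac2 := hac.mul hac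
  have hacF := (hac2.mul hac2).mul htanC.absolutelyContinuousOnInterval
  set F : ℝ → ℝ := (φ * φ * (φ * φ) * fun x => Real.tan (θ x)) with hFdef
  have hFint := hacF.integral_deriv_eq_sub
  have hFi := hacF.intervalIntegrable_deriv
  have hFa : |F a| ≤ Real.tan (β * M / 2) * φ a ^ 4 ∧ |F b| ≤ Real.tan (β * M / 2) * φ b ^ 4 := by
    have key : ∀ x ∈ Set.Icc a b, |F x| ≤ Real.tan (β * M / 2) * φ x ^ 4 := by
      intro x hx
      have h1 := hrange x hx
      have e : F x = φ x ^ 4 * Real.tan (θ x) := by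
        simp only [hFdef, Pi.mul_apply]; ring
      rw [e, abs_mul, abs_of_nonneg (by positivity : 0 ≤ φ x ^ 4), mul_comm]
      apply mul_le_mul_of_nonneg_right _ (by positivity)
      have hmonot := Real.strictMonoOn_tan.monotoneOn
      have i1 : θ x ∈ Set.Ioo (-(Real.pi / 2)) (Real.pi / 2) := by
        constructor <;> linarith
      have i2 : β * M / 2 ∈ Set.Ioo (-(Real.pi / 2)) (Real.pi / 2) := by
        constructor <;> linarith
      have i3 : -(β * M / 2) ∈ Set.Ioo (-(Real.pi / 2)) (Real.pi / 2) := by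
        constructor <;> linarith
      rw [abs_le, ← Real.tan_neg]
      exact ⟨hmonot i3 i1 h1.1, hmonot i1 i2 h1.2⟩
    exact ⟨key a ⟨le_rfl, hab⟩, key b ⟨hab, le_rfl⟩⟩
  have hmain : (∫ x in a..b, (β ^ 2 / 4 * φ x ^ 6 - β / 4 * deriv F x)) ≤
      ∫ x in a..b, d x ^ 2 := by
    apply intervalIntegral.integral_mono_ae_restrict hab
    · exact (((hφ.pow 6).intervalIntegrable _ _).const_mul _).sub (hFi.const_mul _)
    · exact hd2.intervalIntegrable
    · filter_upwards [ae_restrict_of_ae (line_ae_deriv hd hF),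
        ae_restrict_mem measurableSet_Icc] with x hx hxI
      have hc := hcos x hxI
      have h2 := (hx.mul hx).mul (hx.mul hx)
      have h3 := (Real.hasDerivAt_tan hc.ne').comp x (hθ' x)
      have h4 := (h2.mul h3).deriv
      have h5 : deriv F x = 4 * φ x ^ 3 * d x * Real.tan (θ x)
          + β * φ x ^ 6 * (1 + Real.tan (θ x) ^ 2) := by
        have e : F = (φ * φ * (φ * φ) * (Real.tan ∘ θ)) := rfl
        rw [e, h4]
        have e2 : 1 + Real.tan (θ x) ^ 2 = 1 / Real.cos (θ x) ^ 2 := by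
          rw [Real.tan_eq_sin_div_cos]
          field_simp
          linarith [Real.sin_sq_add_cos_sq (θ x)]
        rw [e2]
        simp only [Pi.mul_apply, Function.comp]
        ring
      rw [h5]
      nlinarith [sq_nonneg (d x + β / 2 * Real.tan (θ x) * φ x ^ 3)]
  have hφ6 : IntervalIntegrable (fun x => β ^ 2 / 4 * φ x ^ 6) volume a b :=
    ((hφ.pow 6).intervalIntegrable _ _).const_mul _
  rw [intervalIntegral.integral_sub hφ6 (hFi.const_mul _), intervalIntegral.integral_const_mul,
    intervalIntegral.integral_const_mul, hFint] at hmain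
  have e1 := abs_le.1 hFa.1
  have e2 := abs_le.1 hFa.2
  have : β / 4 * (F b - F a) ≤
      β / 4 * (Real.tan (β * M / 2) * (φ b ^ 4 + φ a ^ 4)) := by
    apply mul_le_mul_of_nonneg_left _ (by positivity)
    nlinarith
  linarith

lemma line_sq_tendsto (hφ : Continuous φ) (hd : LocallyIntegrable d)
    (hF : ∀ x : ℝ, (∫ t in (0:ℝ)..x, d t) = φ x - φ 0)
    (hφ2 : Integrable (fun x => φ x ^ 2))
    (hd2 : Integrable (fun x => d x ^ 2)) :
    Tendsto (fun x => φ x ^ 2) atTop (𝓝 0) ∧ Tendsto (fun x => φ x ^ 2) atBot (𝓝 0) := by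
  have hI : Integrable (fun x => 2 * φ x * d x) := by
    refine (hφ2.add hd2).mono'
      (((hφ.const_mul 2).aestronglyMeasurable).mul hd.aestronglyMeasurable) ?_
    refine Eventually.of_forall fun x => ?_
    rw [Real.norm_eq_abs, abs_le]
    simp only [Pi.add_apply]
    constructor <;> nlinarith [sq_nonneg (φ x + d x), sq_nonneg (φ x - d x)]
  have hG : ∀ a b, (∫ t in a..b, 2 * φ t * d t) = φ b ^ 2 - φ a ^ 2 := by
    intro a b
    have hac := line_ac hd hF a b
    have h := (hac.mul hac).integral_deriv_eq_sub
    have h1 : (∫ t in a..b, deriv (φ * φ) t) = ∫ t in a..b, 2 * φ t * d t := by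
      apply intervalIntegral.integral_congr_ae
      filter_upwards [line_ae_deriv hd hF] with x hx _
      rw [(hx.mul hx).deriv]; ring
    rw [← h1, h]
    simp only [Pi.mul_apply]; ring
  constructor
  · have h1 := intervalIntegral_tendsto_integral_Ioi 0 hI.integrableOn tendsto_id
    have h2 : Tendsto (fun x => φ x ^ 2) atTop
        (𝓝 ((∫ x in Set.Ioi 0, 2 * φ x * d x) + φ 0 ^ 2)) := by
      refine (h1.add_const (φ 0 ^ 2)).congr fun x => ?_
      simp only [id]
      rw [hG]; ring
    have h3 := (hφ2.integrableAtFilter atTop).eq_zero_of_tendsto (by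
      intro s hs
      obtain ⟨a, ha⟩ := mem_atTop_sets.1 hs
      exact top_unique (Real.volume_Ici (a := a) ▸ measure_mono ha)) h2
    rwa [h3] at h2
  · have h1 := intervalIntegral_tendsto_integral_Iic 0 hI.integrableOn tendsto_id
    have h2 : Tendsto (fun x => φ x ^ 2) atBot
        (𝓝 (φ 0 ^ 2 - (∫ x in Set.Iic 0, 2 * φ x * d x))) := by
      refine (h1.const_sub (φ 0 ^ 2)).congr fun x => ?_
      simp only [id]
      rw [hG]; ring
    have h3 := (hφ2.integrableAtFilter atBot).eq_zero_of_tendsto (by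
      intro s hs
      obtain ⟨a, ha⟩ := mem_atBot_sets.1 hs
      exact top_unique (Real.volume_Iic (a := a) ▸ measure_mono ha)) h2
    rwa [h3] at h2

lemma line_beta_ineq (hφ : Continuous φ) (hd : LocallyIntegrable d)
    (hF : ∀ x : ℝ, (∫ t in (0:ℝ)..x, d t) = φ x - φ 0)
    (hφ2 : Integrable (fun x => φ x ^ 2))
    (hd2 : Integrable (fun x => d x ^ 2)) {β : ℝ} (hβ : 0 < β)
    (hβM : β * (∫ x, φ x ^ 2) < Real.pi) :
    Integrable (fun x => φ x ^ 6) ∧ β ^ 2 / 4 * (∫ x, φ x ^ 6) ≤ ∫ x, d x ^ 2 := by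
  obtain ⟨ht, hb⟩ := line_sq_tendsto hφ hd hF hφ2 hd2
  set M := ∫ x, φ x ^ 2 with hM
  set T := Real.tan (β * M / 2)
  have hkey : ∀ᶠ R : ℝ in atTop, β ^ 2 / 4 * ∫ x in (-R)..R, φ x ^ 6 ≤
      (∫ x, d x ^ 2) + β / 4 * (T * (φ R ^ 4 + φ (-R) ^ 4)) := by
    filter_upwards [eventually_ge_atTop 0] with R hR
    have hab : -R ≤ R := by linarith
    refine (line_interval_ineq hφ hd hF hd2 hab hβ (M := M) ?_ hβM).trans ?_
    · rw [intervalIntegral.integral_of_le hab]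
      exact setIntegral_le_integral hφ2 (Eventually.of_forall fun x => sq_nonneg _)
    · gcongr
      rw [intervalIntegral.integral_of_le hab]
      exact setIntegral_le_integral hd2 (Eventually.of_forall fun x => sq_nonneg _)
  have hlim : Tendsto (fun R : ℝ => (∫ x, d x ^ 2) + β / 4 * (T * (φ R ^ 4 + φ (-R) ^ 4)))
      atTop (𝓝 (∫ x, d x ^ 2)) := by
    have h1 := (ht.pow 2)
    have h2 := ((hb.comp tendsto_neg_atTop_atBot).pow 2)
    have h3 := (((h1.add h2).const_mul T).const_mul (β / 4)).const_add (∫ x, d x ^ 2)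
    simp only [Function.comp] at h3
    convert h3 using 2
    · ring
    · simp
  have hInt : Integrable (fun x => φ x ^ 6) := by
    refine integrable_of_intervalIntegral_norm_bounded (l := atTop) (a := fun R : ℝ => -R)
      (b := fun R : ℝ => R) (4 / β ^ 2 * ((∫ x, d x ^ 2) + 1)) ?_ tendsto_neg_atTop_atBot
      tendsto_id ?_
    · intro R
      exact ((hφ.pow 6).locallyIntegrable.integrableOn_isCompact isCompact_Icc).mono_set
        Set.Ioc_subset_Icc_self
    · have h1 : ∀ᶠ R : ℝ in atTop, (∫ x, d x ^ 2) + β / 4 * (T * (φ R ^ 4 + φ (-R) ^ 4))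
          < (∫ x, d x ^ 2) + 1 := hlim.eventually_lt_const (by linarith)
      filter_upwards [hkey, h1] with R h2 h3
      have e : (∫ x in (-R)..R, ‖φ x ^ 6‖) = ∫ x in (-R)..R, φ x ^ 6 := by
        congr 1
        funext x
        rw [Real.norm_of_nonneg (by positivity)]
      rw [e]
      have h4 := h2.trans h3.le
      rw [div_mul_eq_mul_div, le_div_iff₀ (by positivity)]
      linarith
  refine ⟨hInt, ?_⟩
  exact le_of_tendsto_of_tendsto
    ((intervalIntegral_tendsto_integral hInt tendsto_neg_atTop_atBot tendsto_id).const_mul _)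
    hlim hkey

lemma line_real_ineq (hφ : Continuous φ) (hd : LocallyIntegrable d)
    (hF : ∀ x : ℝ, (∫ t in (0:ℝ)..x, d t) = φ x - φ 0)
    (hφ2 : Integrable (fun x => φ x ^ 2))
    (hd2 : Integrable (fun x => d x ^ 2)) :
    Integrable (fun x => φ x ^ 6) ∧
      (∫ x, φ x ^ 6) ≤ 4 / Real.pi ^ 2 * ((∫ x, φ x ^ 2) ^ 2 * ∫ x, d x ^ 2) := by
  set M := ∫ x, φ x ^ 2 with hM
  have hM0 : 0 ≤ M := integral_nonneg fun x => sq_nonneg _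
  rcases hM0.eq_or_lt with h0 | hpos
  · have h1 : (fun x => φ x ^ 2) =ᵐ[volume] 0 :=
      (integral_eq_zero_iff_of_nonneg (fun x => sq_nonneg _) hφ2).1 (hM ▸ h0.symm)
    have h2 : (fun x => φ x ^ 6) =ᵐ[volume] 0 := by
      filter_upwards [h1] with x hx
      have : φ x ^ 2 = 0 := hx
      have e : φ x ^ 6 = (φ x ^ 2) ^ 3 := by ring
      simp [e, this]
    refine ⟨(integrable_zero _ _ _).congr h2.symm, ?_⟩
    rw [integral_congr_ae h2, ← h0]
    simp
  · have hβ : ∀ β ∈ Set.Ioo 0 (Real.pi / M),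
        β ^ 2 / 4 * (∫ x, φ x ^ 6) ≤ ∫ x, d x ^ 2 := fun β hb =>
      (line_beta_ineq hφ hd hF hφ2 hd2 hb.1 ((lt_div_iff₀ hpos).1 hb.2)).2
    have hpm : 0 < Real.pi / M := div_pos Real.pi_pos hpos
    constructor
    · have := (line_beta_ineq hφ hd hF hφ2 hd2 (half_pos hpm)
        ((lt_div_iff₀ hpos).1 (half_lt_self hpm))).1
      exact this
    have hlim : (Real.pi / M) ^ 2 / 4 * (∫ x, φ x ^ 6) ≤ ∫ x, d x ^ 2 := by
      have ht : Tendsto (fun β : ℝ => β ^ 2 / 4 * (∫ x, φ x ^ 6)) (𝓝[<] (Real.pi / M))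
          (𝓝 ((Real.pi / M) ^ 2 / 4 * (∫ x, φ x ^ 6))) := by
        apply Tendsto.mono_left _ nhdsWithin_le_nhds
        exact Continuous.tendsto (by fun_prop) _
      refine le_of_tendsto ht ?_
      filter_upwards [Ioo_mem_nhdsLT hpm] with β hb using hβ β hb
    have hpi := Real.pi_pos
    have e : (∫ x, φ x ^ 6) = 4 / Real.pi ^ 2 * (M ^ 2 *
        ((Real.pi / M) ^ 2 / 4 * (∫ x, φ x ^ 6))) := by
      field_simp
    rw [e]
    gcongr

/-- conversion between the lower integrals and Bochner integrals -/
lemma lint_eq_two (f : ℝ → ℝ) :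
    (∫⁻ x : ℝ, (‖f x‖₊ : ℝ≥0∞) ^ (2 : ℝ)) = ∫⁻ x : ℝ, ENNReal.ofReal (f x ^ 2) := by
  congr 1
  funext x
  rw [← enorm_eq_nnnorm, ← ofReal_norm]
  rw [ENNReal.ofReal_rpow_of_nonneg (norm_nonneg _) (by norm_num)]
  norm_num

lemma lint_eq_six (f : ℝ → ℝ) :
    (∫⁻ x : ℝ, (‖f x‖₊ : ℝ≥0∞) ^ (6 : ℝ)) = ∫⁻ x : ℝ, ENNReal.ofReal (f x ^ 6) := by
  congr 1
  funext x
  rw [← enorm_eq_nnnorm, ← ofReal_norm]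
  rw [ENNReal.ofReal_rpow_of_nonneg (norm_nonneg _) (by norm_num)]
  have : ‖f x‖ ^ (6:ℝ) = ‖f x‖ ^ (6:ℕ) := by exact_mod_cast Real.rpow_natCast _ 6
  rw [this, Real.norm_eq_abs, Even.pow_abs (by decide)]

lemma integrable_sq_of_lint (f : ℝ → ℝ) (hf : AEStronglyMeasurable f)
    (h : (∫⁻ x : ℝ, (‖f x‖₊ : ℝ≥0∞) ^ (2 : ℝ)) < ⊤) : Integrable (fun x => f x ^ 2) := by
  rw [lint_eq_two] at h
  refine ⟨hf.pow 2, ?_⟩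
  rw [hasFiniteIntegral_iff_ofReal (Eventually.of_forall fun x => sq_nonneg _)]
  exact h

lemma line_lint_ineq (h : MemH1R φ d) :
    (∫⁻ x : ℝ, (‖φ x‖₊ : ℝ≥0∞) ^ (6 : ℝ)) ≤ ENNReal.ofReal (4 / Real.pi ^ 2) *
      ((∫⁻ x : ℝ, (‖φ x‖₊ : ℝ≥0∞) ^ (2 : ℝ)) ^ 2 *
        ∫⁻ x : ℝ, (‖d x‖₊ : ℝ≥0∞) ^ (2 : ℝ)) := by
  obtain ⟨hφ, hd, hF, h1, h2⟩ := h
  have i1 := integrable_sq_of_lint φ hφ.aestronglyMeasurable h1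
  have i2 := integrable_sq_of_lint d hd.aestronglyMeasurable h2
  obtain ⟨i6, hle⟩ := line_real_ineq hφ hd hF i1 i2
  rw [lint_eq_six, lint_eq_two, lint_eq_two,
    ← ofReal_integral_eq_lintegral_ofReal i6 (Eventually.of_forall fun x => by positivity),
    ← ofReal_integral_eq_lintegral_ofReal i1 (Eventually.of_forall fun x => by positivity),
    ← ofReal_integral_eq_lintegral_ofReal i2 (Eventually.of_forall fun x => by positivity),
    ← ENNReal.ofReal_pow (integral_nonneg fun x => sq_nonneg _),
    ← ENNReal.ofReal_mul (by positivity), ← ENNReal.ofReal_mul (by positivity)]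
  exact ENNReal.ofReal_le_ofReal hle

lemma quot_le_of_lint {A B C : ℝ≥0∞} {K : ℝ} (hK : 0 ≤ K) (hB : B < ⊤) (hC : C < ⊤)
    (h : A ≤ ENNReal.ofReal K * (B ^ 2 * C)) :
    A.toReal / (B.toReal ^ 2 * C.toReal) ≤ K := by
  apply div_le_of_le_mul₀ (by positivity) hK
  have := ENNReal.toReal_mono (by finiteness) h
  rwa [ENNReal.toReal_mul, ENNReal.toReal_ofReal hK, ENNReal.toReal_mul,
    ENNReal.toReal_pow] at this

end LineInequality

lemma gridH_mem {u : GridFunc} (hu : u.MemH1) :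
    (∀ j, MemH1R (u.h j) (u.hd j)) ∧ (∀ k, MemH1R (u.w k) (u.wd k)) := by
  obtain ⟨h1, h2, h3, h4, h5, h6, h7, h8⟩ := hu
  unfold gridLpPow at h7 h8
  rw [ENNReal.add_lt_top] at h7 h8
  exact ⟨fun j => ⟨h1 j, h3 j, h5 j, (ENNReal.le_tsum j).trans_lt h7.1,
    (ENNReal.le_tsum j).trans_lt h8.1⟩, fun j => ⟨h2 j, h4 j, h6 j,
    (ENNReal.le_tsum j).trans_lt h7.2, (ENNReal.le_tsum j).trans_lt h8.2⟩⟩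

lemma grid_lint_ineq {u : GridFunc} (hu : u.MemH1) :
    gridLpPow 6 u.h u.w ≤ ENNReal.ofReal (4 / Real.pi ^ 2) *
      (gridLpPow 2 u.h u.w ^ 2 * gridLpPow 2 u.hd u.wd) := by
  obtain ⟨hh, hw⟩ := gridH_mem hu
  have key : ∀ (f g : ℤ → ℝ → ℝ), (∀ j, MemH1R (f j) (g j)) →
      (∀ j, (∫⁻ x : ℝ, (‖f j x‖₊ : ℝ≥0∞) ^ (2 : ℝ)) ≤ gridLpPow 2 u.h u.w) →
      (∑' j : ℤ, ∫⁻ x : ℝ, (‖f j x‖₊ : ℝ≥0∞) ^ (6 : ℝ)) ≤ ENNReal.ofReal (4 / Real.pi ^ 2) *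
      (gridLpPow 2 u.h u.w ^ 2 * ∑' j : ℤ, ∫⁻ x : ℝ, (‖g j x‖₊ : ℝ≥0∞) ^ (2 : ℝ)) := by
    intro f g hm hle
    rw [← ENNReal.tsum_mul_left, ← ENNReal.tsum_mul_left]
    refine ENNReal.tsum_le_tsum fun j => (line_lint_ineq (hm j)).trans ?_
    gcongr
    exact hle j
  have k1 := key u.h u.hd hh fun j => (ENNReal.le_tsum
    (f := fun j => ∫⁻ x : ℝ, (‖u.h j x‖₊ : ℝ≥0∞) ^ (2 : ℝ)) j).trans le_self_add
  have k2 := key u.w u.wd hw fun j => (ENNReal.le_tsum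
    (f := fun j => ∫⁻ x : ℝ, (‖u.w j x‖₊ : ℝ≥0∞) ^ (2 : ℝ)) j).trans le_add_self
  have := add_le_add k1 k2
  rw [← mul_add, ← mul_add] at this
  exact this

lemma gnQuot_six (u : GridFunc) : u.gnQuot 6 = (gridLpPow 6 u.h u.w).toReal /
    ((gridLpPow 2 u.h u.w).toReal ^ 2 * (gridLpPow 2 u.hd u.wd).toReal) := by
  unfold GridFunc.gnQuot
  have : ((6:ℝ) - 2) / 2 = (2:ℕ) := by norm_num
  rw [this, Real.rpow_natCast]

lemma grid_upper : 4 / Real.pi ^ 2 ∈ upperBounds (gnSet 6) := by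
  rintro q ⟨u, hu, -, rfl⟩
  rw [gnQuot_six]
  exact quot_le_of_lint (by positivity) hu.2.2.2.2.2.2.1 hu.2.2.2.2.2.2.2 (grid_lint_ineq hu)

lemma line_upper : 4 / Real.pi ^ 2 ∈ upperBounds gnSetR := by
  rintro q ⟨φ, d, h, -, rfl⟩
  exact quot_le_of_lint (by positivity) h.2.2.2.1 h.2.2.2.2 (line_lint_ineq h)

lemma critMass_val : critMass 6 (4 / Real.pi ^ 2) = Real.pi * Real.sqrt 3 / 2 := by
  unfold critMass
  have h1 : (2:ℝ) / (6 - 2) = 1 / 2 := by norm_num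
  rw [h1, ← Real.sqrt_eq_rpow, Real.sqrt_eq_iff_mul_self_eq (by positivity) (by positivity)]
  have h3 := Real.mul_self_sqrt (show (0:ℝ) ≤ 3 by norm_num)
  have : Real.pi * Real.sqrt 3 / 2 * (Real.pi * Real.sqrt 3 / 2)
    = Real.pi ^ 2 * (Real.sqrt 3 * Real.sqrt 3) / 4 := by ring
  rw [this, h3]
  have := Real.pi_pos
  field_simp
  norm_num

section Bump

lemma bump_lint (f : ℝ → ℝ) (hf : Continuous f) :
    (∫⁻ x : ℝ, (‖(Set.Ioc (0:ℝ) 1).indicator f x‖₊ : ℝ≥0∞) ^ (2 : ℝ))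
      = ENNReal.ofReal (∫ x in (0:ℝ)..1, f x ^ 2) ∧
    (∫⁻ x : ℝ, (‖(Set.Ioc (0:ℝ) 1).indicator f x‖₊ : ℝ≥0∞) ^ (6 : ℝ))
      = ENNReal.ofReal (∫ x in (0:ℝ)..1, f x ^ 6) := by
  have key : ∀ n : ℕ, n ≠ 0 → Even n →
      (∫⁻ x : ℝ, ENNReal.ofReal ((Set.Ioc (0:ℝ) 1).indicator f x ^ n))
        = ENNReal.ofReal (∫ x in (0:ℝ)..1, f x ^ n) := by
    intro n hn he
    have e : ∀ x, ENNReal.ofReal ((Set.Ioc (0:ℝ) 1).indicator f x ^ n)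
        = (Set.Ioc (0:ℝ) 1).indicator (fun x => ENNReal.ofReal (f x ^ n)) x := by
      intro x
      by_cases hx : x ∈ Set.Ioc (0:ℝ) 1
      · simp [Set.indicator_of_mem hx]
      · simp [Set.indicator_of_notMem hx, hn]
    simp_rw [e]
    rw [lintegral_indicator measurableSet_Ioc, intervalIntegral.integral_of_le zero_le_one,
      ofReal_integral_eq_lintegral_ofReal]
    · exact ((hf.pow n).locallyIntegrable.integrableOn_isCompact isCompact_Icc).mono_set
        Set.Ioc_subset_Icc_self
    · exact Eventually.of_forall fun x => he.pow_nonneg _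
  exact ⟨by rw [lint_eq_two]; exact key 2 (by norm_num) (by decide),
    by rw [lint_eq_six]; exact key 6 (by norm_num) (by decide)⟩

lemma bump_mem (f g : ℝ → ℝ) (hg : Continuous g) (hfg : ∀ x, HasDerivAt f (g x) x)
    (h0 : f 0 = 0) (h1 : f 1 = 0) :
    MemH1R ((Set.Ioc (0:ℝ) 1).indicator f) ((Set.Ioc (0:ℝ) 1).indicator g) := by
  have hf : Continuous f := continuous_iff_continuousAt.2 fun x => (hfg x).continuousAt
  have hclamp : (Set.Ioc (0:ℝ) 1).indicator f = fun x => f (max 0 (min x 1)) := by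
    funext x
    by_cases hx : x ∈ Set.Ioc (0:ℝ) 1
    · rw [Set.indicator_of_mem hx, min_eq_left hx.2, max_eq_right hx.1.le]
    · rw [Set.indicator_of_notMem hx]
      rcases le_or_gt x 0 with h | h
      · rw [max_eq_left ((min_le_left _ _).trans h), h0]
      · have : 1 < x := by
          by_contra hc
          exact hx ⟨h, not_lt.1 hc⟩
        rw [min_eq_right this.le, max_eq_right zero_le_one, h1]
  refine ⟨?_, ?_, ?_, ?_, ?_⟩
  · rw [hclamp]
    fun_prop
  · exact hg.locallyIntegrable.indicator measurableSet_Ioc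
  · intro x
    rw [Set.indicator_of_notMem (by simp : (0:ℝ) ∉ Set.Ioc (0:ℝ) 1), sub_zero]
    rcases le_or_gt x 0 with h | h
    · rw [Set.indicator_of_notMem (fun hx => absurd hx.1 (not_lt.2 h)),
        intervalIntegral.integral_of_ge h, setIntegral_indicator measurableSet_Ioc]
      have : Set.Ioc x 0 ∩ Set.Ioc 0 1 = ∅ := by
        ext y
        simp only [Set.mem_inter_iff, Set.mem_Ioc, Set.mem_empty_iff_false, iff_false]
        intro hy
        linarith [hy.1.2, hy.2.1]
      rw [this]
      simp
    · rw [hclamp, intervalIntegral.integral_of_le h.le, setIntegral_indicator measurableSet_Ioc,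
        Set.Ioc_inter_Ioc, sup_idem]
      have hp : 0 ≤ min x 1 := le_min h.le zero_le_one
      rw [← intervalIntegral.integral_of_le (μ := volume) hp,
        intervalIntegral.integral_eq_sub_of_hasDerivAt (fun y _ => hfg y)
          (hg.intervalIntegrable _ _), h0, sub_zero]
      simp only [max_eq_right hp]
  · rw [(bump_lint f hf).1]
    exact ENNReal.ofReal_lt_top
  · rw [(bump_lint g hg).1]
    exact ENNReal.ofReal_lt_top

/-- Placing a function on the line `H 0`. -/
def gridOfLine (φ d : ℝ → ℝ) (h : ∀ k : ℤ, φ k = 0) : GridFunc where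
  h := fun j => if j = 0 then φ else 0
  w := fun _ => 0
  hd := fun j => if j = 0 then d else 0
  wd := fun _ => 0
  compat := by
    intro j k
    by_cases hj : j = 0 <;> simp [hj, h]

lemma gridLpPow_single (p : ℝ) (hp : 0 < p) (f : ℝ → ℝ) :
    gridLpPow p (fun j => if j = 0 then f else 0) (fun _ => 0)
      = ∫⁻ x : ℝ, (‖f x‖₊ : ℝ≥0∞) ^ p := by
  unfold gridLpPow
  rw [tsum_eq_single 0]
  · simp [hp]
  · intro j hj
    simp [hj, hp]

lemma gridOfLine_mem {φ d : ℝ → ℝ} (h : ∀ k : ℤ, φ k = 0) (hm : MemH1R φ d) (hne : φ ≠ 0) :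
    gnQuotR φ d ∈ gnSet 6 := by
  obtain ⟨h1, h2, h3, h4, h5⟩ := hm
  refine ⟨gridOfLine φ d h, ⟨?_, ?_, ?_, ?_, ?_, ?_, ?_, ?_⟩, ?_, ?_⟩
  · intro j
    by_cases hj : j = 0
    · simpa [gridOfLine, hj] using h1
    · simpa [gridOfLine, hj] using continuous_zero
  · intro k
    exact continuous_zero
  · intro j
    by_cases hj : j = 0
    · simpa [gridOfLine, hj] using h2
    · simp only [gridOfLine, hj, if_false]
      exact locallyIntegrable_zero
  · intro k
    exact locallyIntegrable_zero
  · intro j x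
    by_cases hj : j = 0
    · simpa [gridOfLine, hj] using h3 x
    · simp [gridOfLine, hj]
  · intro j x
    simp [gridOfLine]
  · exact (gridLpPow_single 2 (by norm_num) φ).trans_lt h4
  · exact (gridLpPow_single 2 (by norm_num) d).trans_lt h5
  · left
    obtain ⟨x, hx⟩ := Function.ne_iff.1 hne
    exact ⟨0, x, by simpa [gridOfLine] using hx⟩
  · rw [gnQuot_six]
    simp only [gridOfLine]
    rw [gridLpPow_single 2 (by norm_num), gridLpPow_single 2 (by norm_num),
      gridLpPow_single 6 (by norm_num)]
    rfl

/-- The profile `sech^{1/2}`. -/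
def sprof (y : ℝ) : ℝ := (Real.sqrt (Real.cosh y))⁻¹

/-- Its derivative. -/
def sprofD (y : ℝ) : ℝ := -(1 / 2) * (sprof y * (Real.sinh y / Real.cosh y))

lemma sprof_pos (y : ℝ) : 0 < sprof y := inv_pos.2 (Real.sqrt_pos.2 (Real.cosh_pos y))

lemma sprof_sq (y : ℝ) : sprof y ^ 2 = 1 / Real.cosh y := by
  unfold sprof
  rw [inv_pow, Real.sq_sqrt (Real.cosh_pos y).le, one_div]

lemma sprof_le_one (y : ℝ) : sprof y ≤ 1 := by
  apply inv_le_one_of_one_le₀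
  rw [Real.one_le_sqrt]
  exact Real.one_le_cosh y

lemma sprof_deriv (y : ℝ) : HasDerivAt sprof (sprofD y) y := by
  have hc := Real.cosh_pos y
  have hs := Real.sqrt_pos.2 hc
  have h := ((Real.hasDerivAt_cosh y).sqrt hc.ne').inv hs.ne'
  refine h.congr_deriv ?_
  unfold sprofD sprof
  rw [Real.sq_sqrt hc.le]
  field_simp

lemma sprof_cont : Continuous sprof :=
  continuous_iff_continuousAt.2 fun x => (sprof_deriv x).continuousAt

lemma sprofD_cont : Continuous sprofD := by
  unfold sprofD
  have := sprof_cont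
  exact continuous_const.mul (this.mul
    (Real.continuous_sinh.div Real.continuous_cosh fun x => (Real.cosh_pos x).ne'))

lemma sprof_anti {y R : ℝ} (hy : y ∈ Set.Icc (-R) R) : sprof R ≤ sprof y := by
  unfold sprof
  apply inv_anti₀ (Real.sqrt_pos.2 (Real.cosh_pos y))
  apply Real.sqrt_le_sqrt
  rw [Real.cosh_le_cosh]
  exact (abs_le.2 hy).trans (le_abs_self R)

lemma invcosh_cont : Continuous fun y => 1 / Real.cosh y :=
  continuous_const.div Real.continuous_cosh fun x => (Real.cosh_pos x).ne'

lemma gd_deriv (y : ℝ) : HasDerivAt (fun y => Real.arctan (Real.sinh y)) (1 / Real.cosh y) y := by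
  have h := (Real.hasDerivAt_sinh y).arctan
  refine h.congr_deriv ?_
  have hc := Real.cosh_pos y
  have : 1 + Real.sinh y ^ 2 = Real.cosh y ^ 2 := by rw [Real.cosh_sq]; ring
  rw [this]
  field_simp

lemma sc_deriv (y : ℝ) : HasDerivAt (fun y => Real.sinh y / Real.cosh y ^ 2)
    (2 * (1 / Real.cosh y) ^ 3 - 1 / Real.cosh y) y := by
  have hc := Real.cosh_pos y
  have h := (Real.hasDerivAt_sinh y).div ((Real.hasDerivAt_cosh y).pow 2) (pow_pos hc 2).ne'
  refine h.congr_deriv ?_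
  have := Real.cosh_sq y
  have e : Real.sinh y ^ 2 = Real.cosh y ^ 2 - 1 := by linarith
  simp only [Pi.pow_apply]
  field_simp
  push_cast
  simp only [pow_one]
  linear_combination (-2 * Real.cosh y) * e

lemma int_sech (R : ℝ) : (∫ y in (-R)..R, 1 / Real.cosh y) = 2 * Real.arctan (Real.sinh R) := by
  rw [intervalIntegral.integral_eq_sub_of_hasDerivAt (fun y _ => gd_deriv y)
    (invcosh_cont.intervalIntegrable _ _)]
  simp [Real.sinh_neg, Real.arctan_neg]
  ring

lemma int_sech_le (R : ℝ) : (∫ y in (-R)..R, 1 / Real.cosh y) ≤ Real.pi := by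
  rw [int_sech]
  linarith [Real.arctan_lt_pi_div_two (Real.sinh R)]

lemma int_sech_cube (R : ℝ) : (∫ y in (-R)..R, (1 / Real.cosh y) ^ 3)
    = Real.arctan (Real.sinh R) + Real.sinh R / Real.cosh R ^ 2 := by
  have hd : ∀ y, HasDerivAt (fun y => (1 / 2) * (Real.arctan (Real.sinh y)
      + Real.sinh y / Real.cosh y ^ 2)) ((1 / Real.cosh y) ^ 3) y := by
    intro y
    refine (((gd_deriv y).add (sc_deriv y)).const_mul (1 / 2)).congr_deriv ?_
    ring
  rw [intervalIntegral.integral_eq_sub_of_hasDerivAt (fun y _ => hd y)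
    ((invcosh_cont.pow 3).intervalIntegrable _ _)]
  simp only [Real.sinh_neg, Real.arctan_neg, Real.cosh_neg]
  ring

lemma int_two_le {R : ℝ} (hR : 0 < R) :
    (∫ y in (-R)..R, (sprof y - sprof R) ^ 2) ≤ Real.pi := by
  refine le_trans ?_ (int_sech_le R)
  apply intervalIntegral.integral_mono_on (by linarith)
  · exact ((sprof_cont.sub continuous_const).pow 2).intervalIntegrable _ _
  · exact invcosh_cont.intervalIntegrable _ _
  · intro y hy
    rw [← sprof_sq]
    have h1 := sprof_anti hy
    have h2 := sprof_pos R
    nlinarith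

lemma int_deriv_le {R : ℝ} (hR : 0 < R) :
    (∫ y in (-R)..R, sprofD y ^ 2) ≤ Real.pi / 8 := by
  have e : (fun y => sprofD y ^ 2)
      = fun y => (1 / 4) * (1 / Real.cosh y - (1 / Real.cosh y) ^ 3) := by
    funext y
    have hc := Real.cosh_pos y
    have h1 : sprofD y ^ 2 = 1 / 4 * (sprof y ^ 2 * (Real.sinh y ^ 2 / Real.cosh y ^ 2)) := by
      unfold sprofD; ring
    have e : Real.sinh y ^ 2 = Real.cosh y ^ 2 - 1 := by linarith [Real.cosh_sq y]
    rw [h1, sprof_sq, e]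
    field_simp
  have h3 : Continuous fun y => (1 / Real.cosh y) ^ 3 := invcosh_cont.pow 3
  rw [e, intervalIntegral.integral_const_mul, intervalIntegral.integral_sub
    (invcosh_cont.intervalIntegrable _ _) (h3.intervalIntegrable _ _),
    int_sech, int_sech_cube]
  have h1 := Real.arctan_lt_pi_div_two (Real.sinh R)
  have h2 : 0 ≤ Real.sinh R / Real.cosh R ^ 2 :=
    div_nonneg (Real.sinh_nonneg_iff.2 hR.le) (by positivity)
  linarith

lemma int_six_ge {R : ℝ} (hR : 0 < R) :
    Real.arctan (Real.sinh R) - 6 * sprof R * Real.pi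
      ≤ ∫ y in (-R)..R, (sprof y - sprof R) ^ 6 := by
  have hle : (∫ y in (-R)..R, ((1 / Real.cosh y) ^ 3 - 6 * sprof R * (1 / Real.cosh y)))
      ≤ ∫ y in (-R)..R, (sprof y - sprof R) ^ 6 := by
    apply intervalIntegral.integral_mono_on (by linarith)
    · exact ((invcosh_cont.pow 3).sub (invcosh_cont.const_mul _)).intervalIntegrable _ _
    · exact ((sprof_cont.sub continuous_const).pow 6).intervalIntegrable _ _
    · intro y hy
      rw [← sprof_sq]
      have h1 := sprof_anti hy
      have h2 := sprof_pos R
      have h3 := sprof_le_one y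
      set a := sprof y
      set δ := sprof R
      have ha : 0 < a := h2.trans_le h1
      have hb := one_add_mul_le_pow (a := -(δ / a)) (by
        have : δ / a ≤ 1 := (div_le_one ha).2 h1
        linarith) 6
      have hmul := mul_le_mul_of_nonneg_left hb (by positivity : 0 ≤ a ^ 6)
      have e1 : a ^ 6 * (1 + -(δ / a)) ^ 6 = (a - δ) ^ 6 := by
        rw [← mul_pow]; congr 1; field_simp; ring
      have e2 : a ^ 6 * (1 + ((6:ℕ):ℝ) * -(δ / a)) = a ^ 6 - 6 * δ * a ^ 5 := by
        field_simp; push_cast; ring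
      rw [e1, e2] at hmul
      have h5 : a ^ 5 ≤ a ^ 2 := pow_le_pow_of_le_one ha.le h3 (by norm_num)
      have h6 : 6 * δ * a ^ 5 ≤ 6 * δ * a ^ 2 := by gcongr
      calc (a ^ 2) ^ 3 - 6 * δ * a ^ 2 ≤ a ^ 6 - 6 * δ * a ^ 5 := by
            have : (a ^ 2) ^ 3 = a ^ 6 := by ring
            linarith
        _ ≤ _ := hmul
  have h3 : Continuous fun y => (1 / Real.cosh y) ^ 3 := invcosh_cont.pow 3
  rw [intervalIntegral.integral_sub (h3.intervalIntegrable _ _)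
    ((invcosh_cont.const_mul _).intervalIntegrable _ _), intervalIntegral.integral_const_mul,
    int_sech_cube] at hle
  have h2 : 0 ≤ Real.sinh R / Real.cosh R ^ 2 :=
    div_nonneg (Real.sinh_nonneg_iff.2 hR.le) (by positivity)
  have h4 : 6 * sprof R * (∫ y in (-R)..R, 1 / Real.cosh y) ≤ 6 * sprof R * Real.pi :=
    mul_le_mul_of_nonneg_left (int_sech_le R) (by have := sprof_pos R; positivity)
  linarith

lemma exists_near {R : ℝ} (hR : 0 < R)
    (hN : 0 < Real.arctan (Real.sinh R) - 6 * sprof R * Real.pi) :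
    ∃ φ d : ℝ → ℝ, MemH1R φ d ∧ φ ≠ 0 ∧ (∀ k : ℤ, φ k = 0) ∧
      8 / Real.pi ^ 3 * (Real.arctan (Real.sinh R) - 6 * sprof R * Real.pi) ≤ gnQuotR φ d := by
  set N := Real.arctan (Real.sinh R) - 6 * sprof R * Real.pi with hNdef
  set f : ℝ → ℝ := fun x => sprof (2 * R * x - R) - sprof R with hf
  set g : ℝ → ℝ := fun x => 2 * R * sprofD (2 * R * x - R) with hg
  have hfc : Continuous f := by
    have := sprof_cont
    fun_prop
  have hgc : Continuous g := by
    have := sprofD_cont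
    fun_prop
  have hfg : ∀ x, HasDerivAt f (g x) x := by
    intro x
    have h1 : HasDerivAt (fun x : ℝ => 2 * R * x - R) (2 * R) x := by
      simpa using ((hasDerivAt_id x).const_mul (2 * R)).sub_const R
    have h2 := ((sprof_deriv (2 * R * x - R)).comp x h1).sub_const (sprof R)
    refine h2.congr_deriv ?_
    simp only [hg]; ring
  have h0 : f 0 = 0 := by
    simp only [hf, sprof, mul_zero, zero_sub, Real.cosh_neg, sub_self]
  have h1 : f 1 = 0 := by
    simp only [hf]
    rw [show 2 * R * 1 - R = R by ring, sub_self]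
  have hm := bump_mem f g hgc hfg h0 h1
  have sub : ∀ G : ℝ → ℝ, (∫ x in (0:ℝ)..1, G (2 * R * x - R))
      = (2 * R)⁻¹ * ∫ y in (-R)..R, G y := by
    intro G
    rw [intervalIntegral.integral_comp_mul_sub G (by positivity : 2 * R ≠ 0) R]
    rw [show 2 * R * 0 - R = -R by ring, show 2 * R * 1 - R = R by ring, smul_eq_mul]
  have hS : (2 * R)⁻¹ * N ≤ ∫ x in (0:ℝ)..1, f x ^ 6 := by
    rw [sub (fun y => (sprof y - sprof R) ^ 6)]
    have := int_six_ge hR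
    gcongr
  have hP : (∫ x in (0:ℝ)..1, f x ^ 2) ≤ (2 * R)⁻¹ * Real.pi := by
    rw [sub (fun y => (sprof y - sprof R) ^ 2)]
    have := int_two_le hR
    gcongr
  have hD : (∫ x in (0:ℝ)..1, g x ^ 2) ≤ 2 * R * (Real.pi / 8) := by
    have e : (fun x => g x ^ 2) = fun x => (2 * R) ^ 2 * sprofD (2 * R * x - R) ^ 2 := by
      funext x; simp only [hg]; ring
    rw [e, intervalIntegral.integral_const_mul, sub (fun y => sprofD y ^ 2)]
    have := int_deriv_le hR
    calc (2 * R) ^ 2 * ((2 * R)⁻¹ * ∫ y in (-R)..R, sprofD y ^ 2)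
        = 2 * R * ∫ y in (-R)..R, sprofD y ^ 2 := by field_simp
      _ ≤ _ := by gcongr
  have hP0 : 0 ≤ ∫ x in (0:ℝ)..1, f x ^ 2 :=
    intervalIntegral.integral_nonneg zero_le_one fun x _ => sq_nonneg _
  have hD0 : 0 ≤ ∫ x in (0:ℝ)..1, g x ^ 2 :=
    intervalIntegral.integral_nonneg zero_le_one fun x _ => sq_nonneg _
  have hSpos : 0 < ∫ x in (0:ℝ)..1, f x ^ 6 :=
    (by positivity : 0 < (2 * R)⁻¹ * N).trans_le hS
  have hq := line_lint_ineq hm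
  rw [(bump_lint f hfc).1, (bump_lint f hfc).2, (bump_lint g hgc).1,
    ← ENNReal.ofReal_pow hP0, ← ENNReal.ofReal_mul (by positivity),
    ← ENNReal.ofReal_mul (by positivity),
    ENNReal.ofReal_le_ofReal_iff (by positivity)] at hq
  refine ⟨_, _, hm, ?_, ?_, ?_⟩
  · intro hz
    have h6 := (bump_lint f hfc).2
    rw [hz] at h6
    simp at h6
    linarith
  · intro k
    by_cases hk : (k : ℝ) ∈ Set.Ioc (0:ℝ) 1
    · have h2 : 0 < k := by exact_mod_cast hk.1
      have h3 : k ≤ 1 := by exact_mod_cast hk.2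
      have : k = 1 := by omega
      rw [Set.indicator_of_mem hk, this]
      simpa using h1
    · exact Set.indicator_of_notMem hk _
  · unfold gnQuotR
    rw [(bump_lint f hfc).1, (bump_lint f hfc).2, (bump_lint g hgc).1,
      ENNReal.toReal_ofReal hP0, ENNReal.toReal_ofReal hD0, ENNReal.toReal_ofReal hSpos.le]
    set P := ∫ x in (0:ℝ)..1, f x ^ 2
    set D := ∫ x in (0:ℝ)..1, g x ^ 2
    set S := ∫ x in (0:ℝ)..1, f x ^ 6
    have hpos : 0 < P ^ 2 * D := by
      by_contra hc
      have : P ^ 2 * D = 0 := le_antisymm (not_lt.1 hc) (by positivity)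
      rw [this, mul_zero] at hq
      linarith
    rw [le_div_iff₀ hpos]
    have hpi := Real.pi_pos
    calc 8 / Real.pi ^ 3 * N * (P ^ 2 * D)
        ≤ 8 / Real.pi ^ 3 * N * (((2 * R)⁻¹ * Real.pi) ^ 2 * (2 * R * (Real.pi / 8))) := by
          gcongr
      _ = (2 * R)⁻¹ * N := by field_simp
      _ ≤ S := hS

lemma near_tendsto : Tendsto (fun R => Real.arctan (Real.sinh R) - 6 * sprof R * Real.pi) atTop
    (𝓝 (Real.pi / 2)) := by
  have hs : Tendsto Real.sinh atTop atTop := by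
    refine tendsto_atTop_mono' _ ?_ tendsto_id
    filter_upwards [eventually_ge_atTop 0] with x hx
    exact Real.self_le_sinh_iff.2 hx
  have hc : Tendsto Real.cosh atTop atTop :=
    tendsto_atTop_mono (fun x => (Real.sinh_lt_cosh x).le) hs
  have h1 : Tendsto (fun R => Real.arctan (Real.sinh R)) atTop (𝓝 (Real.pi / 2)) :=
    (Real.tendsto_arctan_atTop.mono_right nhdsWithin_le_nhds).comp hs
  have h2 : Tendsto sprof atTop (𝓝 0) :=
    tendsto_inv_atTop_zero.comp (Real.tendsto_sqrt_atTop.comp hc)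
  simpa using h1.sub ((h2.const_mul 6).mul_const Real.pi)

lemma lower_of_near {s : Set ℝ}
    (h : ∀ φ d : ℝ → ℝ, MemH1R φ d → φ ≠ 0 → (∀ k : ℤ, φ k = 0) → gnQuotR φ d ∈ s) :
    4 / Real.pi ^ 2 ∈ lowerBounds (upperBounds s) := by
  intro c hc
  have ht := near_tendsto.const_mul (8 / Real.pi ^ 3)
  have e : 8 / Real.pi ^ 3 * (Real.pi / 2) = 4 / Real.pi ^ 2 := by
    have := Real.pi_pos
    field_simp; norm_num
  rw [e] at ht
  refine le_of_tendsto ht ?_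
  filter_upwards [eventually_gt_atTop 0,
    near_tendsto.eventually_const_lt (by have := Real.pi_pos; positivity)] with R hR hN
  obtain ⟨φ, d, h1, h2, h3, h4⟩ := exists_near hR hN
  exact h4.trans (hc (h φ d h1 h2 h3))

end Bump

/-- **Sharp sextic Gagliardo–Nirenberg constant on the grid (Prop. 4.3)**:
the optimal constant `K_6` on the grid equals `4/π²`, the critical mass
`μ_6 = (3/K_6)^{1/2} = (6/(2K_6))^{2/(6−2)}` equals `π√3/2`, and `K_6`
coincides with the optimal constant `K^ℝ = 4/π²` on the real line. -/
theorem grid_sharp_sextic_constant :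
    IsLUB (gnSet 6) (4 / Real.pi ^ 2) ∧
    critMass 6 (4 / Real.pi ^ 2) = Real.pi * Real.sqrt 3 / 2 ∧
    IsLUB gnSetR (4 / Real.pi ^ 2) := by
  refine ⟨⟨grid_upper, lower_of_near fun φ d h1 h2 h3 => gridOfLine_mem h3 h1 h2⟩, critMass_val,
    line_upper, lower_of_near fun φ d h1 h2 _ => ⟨φ, d, h1, h2, rfl⟩⟩

end
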